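/- Let A be a real m×m matrix all of whose complex eigenvalues have strictly negative real part (A is Hurwitz). Then there exists a real symmetric positive definite m×m matrix P satisfying the Lyapunov equation P A + Aᵀ P = -1, where 1 is the identity matrix. -/

import Mathlib

open Matrix Polynomial

section aux
attribute [local instance] Matrix.frobeniusNormedRing Matrix.frobeniusNormedAlgebra

theorem aux_pow_bound {m : ℕ} [Nonempty (Fin m)] (B : Matrix (Fin m) (Fin m) ℝ)
    (hB : ∀ z ∈ spectrum ℂ (B.map (algebraMap ℝ ℂ)), ‖z‖ < 1) :
    ∃ r : NNReal, r < 1 ∧ ∀ᶠ n : ℕ in Filter.atTop, ‖B ^ n‖ ≤ (r : ℝ) ^ n := by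
  haveI : CompleteSpace (Matrix (Fin m) (Fin m) ℂ) := FiniteDimensional.complete ℂ _
  have h1 : spectralRadius ℂ (B.map (algebraMap ℝ ℂ)) < (1 : NNReal) :=
    spectrum.spectralRadius_lt_of_forall_lt _ (fun z hz => by
      have := hB z hz
      exact_mod_cast this)
  obtain ⟨r, hr1, hr2⟩ := ENNReal.lt_iff_exists_nnreal_btwn.1 h1
  refine ⟨r, by exact_mod_cast hr2, ?_⟩
  have h2 := (spectrum.pow_nnnorm_pow_one_div_tendsto_nhds_spectralRadius
    (B.map (algebraMap ℝ ℂ))).eventually (gt_mem_nhds hr1)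
  filter_upwards [h2, Filter.eventually_gt_atTop 0] with n hn hn0
  have hn' : (0 : ℝ) < n := by exact_mod_cast hn0
  have h3 : ((‖(B.map (algebraMap ℝ ℂ)) ^ n‖₊ : NNReal) : ENNReal) ≤ (r : ENNReal) ^ n := by
    have := ENNReal.rpow_le_rpow hn.le hn'.le
    rw [← ENNReal.rpow_mul, one_div, inv_mul_cancel₀ hn'.ne', ENNReal.rpow_one,
      ENNReal.rpow_natCast] at this
    exact this
  have h4 : ‖(B.map (algebraMap ℝ ℂ)) ^ n‖₊ ≤ r ^ n := by exact_mod_cast h3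
  have h5 : (B.map (algebraMap ℝ ℂ)) ^ n = (B ^ n).map (algebraMap ℝ ℂ) :=
    (Matrix.map_pow B (algebraMap ℝ ℂ) n).symm
  rw [h5, Matrix.frobenius_nnnorm_map_eq _ _ (fun a => by simp)] at h4
  exact_mod_cast h4

theorem aux_stein {m : ℕ} [Nonempty (Fin m)] (B C : Matrix (Fin m) (Fin m) ℝ) (hC : C.PosDef)
    (hB : ∀ z ∈ spectrum ℂ (B.map (algebraMap ℝ ℂ)), ‖z‖ < 1) :
    ∃ Q : Matrix (Fin m) (Fin m) ℝ, Q.PosDef ∧ Q = C + Bᵀ * Q * B := by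
  haveI : CompleteSpace (Matrix (Fin m) (Fin m) ℝ) := FiniteDimensional.complete ℝ _
  obtain ⟨r, hr, hb⟩ := aux_pow_bound B hB
  have hr' : (r : ℝ) < 1 := by exact_mod_cast hr
  set T : ℕ → Matrix (Fin m) (Fin m) ℝ := fun k => (B ^ k)ᵀ * C * B ^ k with hT
  have hpsd : ∀ k, (T k).PosSemidef := fun k => by
    have := hC.posSemidef.conjTranspose_mul_mul_same (B ^ k)
    simpa [hT, conjTranspose_eq_transpose_of_trivial] using this
  have hs : Summable T := by
    have hg : Summable (fun k : ℕ => ‖C‖ * ((r : ℝ) ^ 2) ^ k) :=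
      (summable_geometric_of_lt_one (by positivity)
        (by nlinarith [r.coe_nonneg])).mul_left _
    refine Summable.of_norm_bounded_eventually_nat hg ?_
    filter_upwards [hb] with k hk
    calc ‖(B ^ k)ᵀ * C * B ^ k‖ ≤ ‖(B ^ k)ᵀ * C‖ * ‖B ^ k‖ := norm_mul_le _ _
      _ ≤ ‖(B ^ k)ᵀ‖ * ‖C‖ * ‖B ^ k‖ := by gcongr; exact norm_mul_le _ _
      _ = ‖B ^ k‖ * ‖C‖ * ‖B ^ k‖ := by rw [Matrix.frobenius_norm_transpose]
      _ ≤ (r : ℝ) ^ k * ‖C‖ * (r : ℝ) ^ k := by gcongr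
      _ = ‖C‖ * ((r : ℝ) ^ 2) ^ k := by ring
  obtain ⟨Q, hQ⟩ := hs
  have hshift : HasSum (fun k => T (k + 1)) (Bᵀ * Q * B) := by
    have := (hQ.mul_left Bᵀ).mul_right B
    have h2 : (fun k => T (k + 1)) = fun k => Bᵀ * T k * B := by
      funext k
      simp only [hT, pow_succ, Matrix.transpose_mul, mul_assoc]
    rw [h2]
    exact this
  have heq : Q = C + Bᵀ * Q * B := by
    have h := hshift.zero_add
    have := hQ.unique h
    simpa [hT] using this
  have hpq : Q.PosSemidef := by
    refine Matrix.PosSemidef.of_dotProduct_mulVec_nonneg ?_ ?_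
    · have h1 := hQ.matrix_conjTranspose
      have h2 : (fun k => (T k)ᴴ) = T := funext fun k => (hpsd k).1
      rw [h2] at h1
      exact h1.unique hQ
    · intro x
      let φ : Matrix (Fin m) (Fin m) ℝ →+ ℝ :=
        { toFun := fun M => star x ⬝ᵥ (M *ᵥ x)
          map_zero' := by simp
          map_add' := fun M N => by simp [Matrix.add_mulVec] }
      have hφ : Continuous φ := by
        change Continuous (fun M : Matrix (Fin m) (Fin m) ℝ => star x ⬝ᵥ (M *ᵥ x))
        fun_prop
      exact (hQ.map φ hφ).nonneg (fun k => (hpsd k).dotProduct_mulVec_nonneg x)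
  refine ⟨Q, ?_, heq⟩
  rw [heq]
  refine hC.add_posSemidef ?_
  simpa [conjTranspose_eq_transpose_of_trivial] using hpq.conjTranspose_mul_mul_same B

end aux

/-- For a Hurwitz real matrix `A` there exists a symmetric positive definite `P`
solving the Lyapunov equation `P A + Aᵀ P = -1`. -/
theorem lyapunov_equation_solvable
    {m : ℕ} (A : Matrix (Fin m) (Fin m) ℝ)
    (hA : ∀ lam ∈ ((A.map (algebraMap ℝ ℂ)).charpoly).roots, lam.re < 0) :
    ∃ P : Matrix (Fin m) (Fin m) ℝ, P.PosDef ∧ P * A + Aᵀ * P = -1 := by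
  rcases isEmpty_or_nonempty (Fin m) with he | hne
  · exact ⟨1, Matrix.PosDef.one, Subsingleton.elim _ _⟩
  set Ac := A.map (algebraMap ℝ ℂ) with hAc
  -- eigenvector form of the hypothesis
  have hE : ∀ (l : ℂ) (w : Fin m → ℂ), w ≠ 0 → Ac *ᵥ w = l • w → l.re < 0 := by
    intro l w hw h
    apply hA
    rw [Polynomial.mem_roots (Matrix.charpoly_monic _).ne_zero,
      ← Matrix.mem_spectrum_iff_isRoot_charpoly, spectrum.mem_iff,
      Matrix.isUnit_iff_isUnit_det, isUnit_iff_ne_zero, not_not,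
      ← Matrix.exists_mulVec_eq_zero_iff]
    refine ⟨w, hw, ?_⟩
    rw [Matrix.sub_mulVec, h, Algebra.algebraMap_eq_smul_one, Matrix.smul_mulVec, Matrix.one_mulVec,
      sub_self]
  have hmapsub : (1 - A).map (algebraMap ℝ ℂ) = 1 - Ac := by
    have := (algebraMap ℝ ℂ).mapMatrix.map_sub (1 : Matrix (Fin m) (Fin m) ℝ) A
    rw [map_one] at this
    exact this
  have hmapadd : (1 + A).map (algebraMap ℝ ℂ) = 1 + Ac := by
    have := (algebraMap ℝ ℂ).mapMatrix.map_add (1 : Matrix (Fin m) (Fin m) ℝ) A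
    rw [map_one] at this
    exact this
  have hdet : IsUnit (1 - A).det := by
    rw [isUnit_iff_ne_zero]
    intro h0
    have h1 : (1 - Ac).det = 0 := by
      rw [← hmapsub]
      have := (algebraMap ℝ ℂ).map_det (1 - A)
      rw [h0, map_zero] at this
      exact this.symm
    obtain ⟨w, hw, h⟩ := Matrix.exists_mulVec_eq_zero_iff.2 h1
    rw [Matrix.sub_mulVec, Matrix.one_mulVec, sub_eq_zero] at h
    have := hE 1 w hw (by rw [one_smul]; exact h.symm)
    norm_num at this
  set R := (1 - A)⁻¹ with hR
  have hR1 : (1 - A) * R = 1 := Matrix.mul_nonsing_inv _ hdet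
  have hR2 : R * (1 - A) = 1 := Matrix.nonsing_inv_mul _ hdet
  set B := (1 + A) * R with hBdef
  set Rc := R.map (algebraMap ℝ ℂ) with hRc
  have hRc1 : (1 - Ac) * Rc = 1 := by
    have := congrArg (algebraMap ℝ ℂ).mapMatrix hR1
    rw [map_mul, map_one] at this
    rw [← hmapsub]
    exact this
  have hBc : B.map (algebraMap ℝ ℂ) = (1 + Ac) * Rc := by
    have := (algebraMap ℝ ℂ).mapMatrix.map_mul (1 + A) R
    rw [← hmapadd]
    exact this
  have hspec : ∀ z ∈ spectrum ℂ (B.map (algebraMap ℝ ℂ)), ‖z‖ < 1 := by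
    intro z hz
    rw [spectrum.mem_iff, Matrix.isUnit_iff_isUnit_det, isUnit_iff_ne_zero, not_not,
      ← Matrix.exists_mulVec_eq_zero_iff] at hz
    obtain ⟨v, hv, h⟩ := hz
    rw [Matrix.sub_mulVec, Algebra.algebraMap_eq_smul_one, Matrix.smul_mulVec, Matrix.one_mulVec,
      sub_eq_zero, hBc, ← Matrix.mulVec_mulVec] at h
    set w := Rc *ᵥ v with hw
    have hvw : v = w - Ac *ᵥ w := by
      have : (1 - Ac) *ᵥ w = v := by rw [hw, Matrix.mulVec_mulVec, hRc1, Matrix.one_mulVec]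
      rw [← this, Matrix.sub_mulVec, Matrix.one_mulVec]
    have hw0 : w ≠ 0 := by
      intro h0
      apply hv
      rw [hvw, h0]; simp
    rw [hvw, Matrix.add_mulVec, Matrix.one_mulVec] at h
    have hz1 : z + 1 ≠ 0 := by
      intro h0
      have hz' : z = -1 := eq_neg_of_add_eq_zero_left h0
      apply hw0
      ext i
      have := congrFun h i
      simp [hz'] at this
      have h2 : 2 * w i = 0 := by linear_combination -this
      simpa using h2
    have hl := hE ((z - 1) / (z + 1)) w hw0 (by
      ext i
      have := congrFun h i
      simp only [Pi.smul_apply, Pi.sub_apply, Pi.add_apply, smul_eq_mul] at this ⊢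
      field_simp
      linear_combination -this)
    rw [Complex.div_re, ← add_div] at hl
    have hpos : 0 < Complex.normSq (z + 1) := Complex.normSq_pos.2 hz1
    rw [div_lt_iff₀ hpos] at hl
    simp at hl
    have : ‖z‖ ^ 2 < 1 := by
      rw [← Complex.normSq_eq_norm_sq, Complex.normSq_apply]
      nlinarith
    nlinarith [norm_nonneg z]
  have hinj : Function.Injective R.mulVec := by
    apply Matrix.mulVec_injective_of_isUnit
    exact ⟨⟨R, 1 - A, hR2, hR1⟩, rfl⟩
  have hC1 : (Rᵀ * R).PosDef := by
    have := Matrix.PosDef.conjTranspose_mul_self R hinj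
    rwa [conjTranspose_eq_transpose_of_trivial] at this
  have hC2 : (Rᵀ * R + Rᵀ * R).PosDef := hC1.add hC1
  obtain ⟨Q, hQ, hQe⟩ := aux_stein B _ hC2 hspec
  refine ⟨Q, hQ, ?_⟩
  have hBR : B * (1 - A) = 1 + A := by rw [hBdef, mul_assoc, hR2, mul_one]
  have hBRt : (1 - A)ᵀ * Bᵀ = (1 + A)ᵀ := by rw [← Matrix.transpose_mul, hBR]
  have hRt : (1 - A)ᵀ * Rᵀ = 1 := by rw [← Matrix.transpose_mul, hR2, Matrix.transpose_one]
  have key : (1 - A)ᵀ * Q * (1 - A) = 1 + 1 + (1 + A)ᵀ * Q * (1 + A) := by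
    calc (1 - A)ᵀ * Q * (1 - A)
        = (1 - A)ᵀ * (Rᵀ * R + Rᵀ * R + Bᵀ * Q * B) * (1 - A) := by rw [← hQe]
      _ = ((1 - A)ᵀ * Rᵀ) * (R * (1 - A)) + ((1 - A)ᵀ * Rᵀ) * (R * (1 - A))
          + ((1 - A)ᵀ * Bᵀ) * Q * (B * (1 - A)) := by noncomm_ring
      _ = _ := by rw [hRt, hR2, hBR, hBRt, one_mul]
  rw [Matrix.transpose_sub, Matrix.transpose_add, Matrix.transpose_one] at key
  have k2 : (2 : ℝ) • (Q * A + Aᵀ * Q + 1) = 0 := by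
    rw [two_smul]
    have e : (Q * A + Aᵀ * Q + 1) + (Q * A + Aᵀ * Q + 1) =
      (1 + 1 + (1 + Aᵀ) * Q * (1 + A)) - (1 - Aᵀ) * Q * (1 - A) := by noncomm_ring
    rw [e, key, sub_self]
  have k3 := (smul_eq_zero.1 k2).resolve_left two_ne_zero
  exact eq_neg_of_add_eq_zero_left k3
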